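/- arXiv:1809.07029 — 4 statements merged into one kernel-verified Lean document; each statement's English description precedes it below -/
import Mathlib

section
/- Let a, E : ℝ² → ℝ be continuous functions with a(x) > 0 and E(x) > 0 for all x, and let g : ℝ² → ℝ be integrable. Suppose w₁, w₂ : ℝ² → ℝ are twice continuously differentiable and for k = 1, 2: Δw_k(x) = 4a(x)e^{w_k(x)}/(E(x) + a(x)e^{w_k(x)}) − g(x) for all x ∈ ℝ², w_k(x) converges to a finite constant b_k as |x| → ∞, and the function x ↦ 4a(x)e^{w_k(x)}/(E(x) + a(x)e^{w_k(x)}) is integrable with ∫_{ℝ²} 4a(x)e^{w_k(x)}/(E(x) + a(x)e^{w_k(x)}) dx = ∫_{ℝ²} g dx. Then w₁ = w₂ on ℝ². -/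
open Real MeasureTheory Metric Set Filter

noncomputable section

abbrev Pt : Type := EuclideanSpace ℝ (Fin 2)

/-- The Laplacian on ℝ²: sum of second partial derivatives. -/
def lapl (f : Pt → ℝ) (x : Pt) : ℝ :=
  ∑ i : Fin 2, fderiv ℝ (fun y => fderiv ℝ f y (EuclideanSpace.single i 1)) x
      (EuclideanSpace.single i 1)

/-- The second derivative in any direction is nonnegative at a local minimum. -/
theorem fderiv_fderiv_apply_nonneg_of_isLocalMin {V : Type*} [NormedAddCommGroup V]
    [NormedSpace ℝ V] {f : V → ℝ} (hf : ContDiff ℝ 2 f) {x : V} (hx : IsLocalMin f x) (v : V) :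
    0 ≤ fderiv ℝ (fun y => fderiv ℝ f y v) x v := by
  have hline : ∀ t : ℝ, HasDerivAt (fun s : ℝ => x + s • v) v t := fun t => by
    simpa using ((hasDerivAt_id t).smul_const v).const_add x
  have hdir : Differentiable ℝ (fun y => fderiv ℝ f y v) :=
    ((hf.fderiv_right (m := 1) (by norm_num)).differentiable (by norm_num)).clm_apply
      (differentiable_const v)
  set φ : ℝ → ℝ := fun t => f (x + t • v) with hφ
  have hφ' : deriv φ = fun t => fderiv ℝ f (x + t • v) v := by
    funext t
    exact ((hf.differentiable (by norm_num) _).hasFDerivAt.comp_hasDerivAt t (hline t)).deriv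
  have hφ'' : deriv (deriv φ) 0 = fderiv ℝ (fun y => fderiv ℝ f y v) x v := by
    rw [hφ']
    simpa [Function.comp_def] using ((hdir (x + (0 : ℝ) • v)).hasFDerivAt.comp_hasDerivAt 0 (hline 0)).deriv
  have hcont : Continuous (fun t : ℝ => x + t • v) := by fun_prop
  have hmin : IsLocalMin φ 0 := by
    have htend : Tendsto (fun t : ℝ => x + t • v) (nhds 0) (nhds x) := by
      simpa using hcont.tendsto 0
    simpa [IsLocalMin, IsMinFilter, hφ] using htend.eventually hx
  rw [← hφ'']
  by_contra! hneg
  have hmax : IsLocalMax φ 0 :=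
    isLocalMax_of_deriv_deriv_neg hneg hmin.deriv_eq_zero
      (hf.continuous.comp hcont).continuousAt
  have hconst : φ =ᶠ[nhds 0] fun _ => φ 0 := by
    filter_upwards [hmin, hmax] with t h₁ h₂ using le_antisymm h₂ h₁
  rw [hconst.deriv.deriv_eq] at hneg
  simp at hneg

theorem lapl_nonneg_of_isLocalMin {f : Pt → ℝ} (hf : ContDiff ℝ 2 f) {x : Pt}
    (hx : IsLocalMin f x) : 0 ≤ lapl f x :=
  Finset.sum_nonneg fun _ _ => fderiv_fderiv_apply_nonneg_of_isLocalMin hf hx _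

theorem lapl_sub {f h : Pt → ℝ} (hf : ContDiff ℝ 2 f) (hh : ContDiff ℝ 2 h) (x : Pt) :
    lapl (fun y => f y - h y) x = lapl f x - lapl h x := by
  have hdir : ∀ {k : Pt → ℝ}, ContDiff ℝ 2 k → ∀ v : Pt,
      Differentiable ℝ (fun y => fderiv ℝ k y v) := fun hk v =>
    ((hk.fderiv_right (m := 1) (by norm_num)).differentiable (by norm_num)).clm_apply
      (differentiable_const v)
  unfold lapl
  rw [← Finset.sum_sub_distrib]
  refine Finset.sum_congr rfl fun i _ => ?_
  have hsub : (fun y => fderiv ℝ (fun z => f z - h z) y (EuclideanSpace.single i 1)) =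
      fun y => fderiv ℝ f y (EuclideanSpace.single i 1) -
        fderiv ℝ h y (EuclideanSpace.single i 1) := by
    funext y
    rw [fderiv_fun_sub (hf.differentiable (by norm_num) y) (hh.differentiable (by norm_num) y)]
    rfl
  rw [hsub, fderiv_fun_sub (hdir hf _ x) (hdir hh _ x)]
  rfl

theorem strictMono_mul_exp_div {A B : ℝ} (hA : 0 < A) (hB : 0 < B) :
    StrictMono fun s : ℝ => 4 * A * Real.exp s / (B + A * Real.exp s) := by
  intro s t hst
  have hexp := mul_pos (mul_pos hA hB) (sub_pos.2 (Real.exp_lt_exp.2 hst))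
  have hs := Real.exp_pos s
  have ht := Real.exp_pos t
  dsimp only
  rw [div_lt_div_iff₀ (by positivity) (by positivity)]
  linarith

/-- Comparison principle: the solution with the larger limit at infinity is the larger one. -/
theorem le_of_lapl_eq_of_tendsto {F : Pt → ℝ → ℝ} {g w v : Pt → ℝ} {b c : ℝ}
    (hF : ∀ x, StrictMono (F x)) (hw : ContDiff ℝ 2 w) (hv : ContDiff ℝ 2 v)
    (hweq : ∀ x, lapl w x = F x (w x) - g x) (hveq : ∀ x, lapl v x = F x (v x) - g x)
    (hwlim : Tendsto w (cocompact Pt) (nhds b)) (hvlim : Tendsto v (cocompact Pt) (nhds c))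
    (hbc : b ≤ c) : w ≤ v := by
  intro x₀
  by_contra! hlt
  obtain ⟨x, hx⟩ := (hv.continuous.sub hw.continuous).exists_forall_le' x₀
    (((hvlim.sub hwlim).eventually_const_lt
      (show v x₀ - w x₀ < c - b by linarith)).mono fun _ h => h.le)
  have hnonneg := lapl_nonneg_of_isLocalMin (hv.sub hw) (Filter.Eventually.of_forall hx)
  rw [lapl_sub hv hw, hweq, hveq] at hnonneg
  have hx₀ : v x - w x ≤ v x₀ - w x₀ := hx x₀
  have := hF x (show v x < w x by linarith)
  linarith

theorem eq_of_le_of_integral_eq {F : Pt → ℝ → ℝ} {w v : Pt → ℝ}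
    (hF : ∀ x, StrictMono (F x)) (hwcont : Continuous fun x => F x (w x))
    (hvcont : Continuous fun x => F x (v x)) (hwint : Integrable fun x => F x (w x))
    (hvint : Integrable fun x => F x (v x)) (hint : ∫ x, F x (w x) = ∫ x, F x (v x))
    (hle : w ≤ v) : w = v := by
  have hae := (integral_eq_iff_of_ae_le hwint hvint
    (Filter.Eventually.of_forall fun x => (hF x).monotone (hle x))).1 hint
  have heq := (hwcont.ae_eq_iff_eq volume hvcont).1 hae
  exact funext fun x => (hF x).injective (congrFun heq x)

/-- uniqueness of solutions converging to constants at infinity. -/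
theorem statement1 (a E g : Pt → ℝ) (ha : Continuous a) (hE : Continuous E)
    (hapos : ∀ x : Pt, 0 < a x) (hEpos : ∀ x : Pt, 0 < E x) (hg : Integrable g)
    (w₁ w₂ : Pt → ℝ) (b₁ b₂ : ℝ)
    (hw₁ : ContDiff ℝ 2 w₁) (hw₂ : ContDiff ℝ 2 w₂)
    (heq₁ : ∀ x : Pt, lapl w₁ x =
      4 * a x * Real.exp (w₁ x) / (E x + a x * Real.exp (w₁ x)) - g x)
    (heq₂ : ∀ x : Pt, lapl w₂ x =
      4 * a x * Real.exp (w₂ x) / (E x + a x * Real.exp (w₂ x)) - g x)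
    (hlim₁ : Tendsto w₁ (cocompact Pt) (nhds b₁))
    (hlim₂ : Tendsto w₂ (cocompact Pt) (nhds b₂))
    (hint₁ : Integrable (fun x : Pt =>
      4 * a x * Real.exp (w₁ x) / (E x + a x * Real.exp (w₁ x))))
    (hint₂ : Integrable (fun x : Pt =>
      4 * a x * Real.exp (w₂ x) / (E x + a x * Real.exp (w₂ x))))
    (hval₁ : ∫ x : Pt, 4 * a x * Real.exp (w₁ x) / (E x + a x * Real.exp (w₁ x))
      = ∫ x : Pt, g x)
    (hval₂ : ∫ x : Pt, 4 * a x * Real.exp (w₂ x) / (E x + a x * Real.exp (w₂ x))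
      = ∫ x : Pt, g x) :
    w₁ = w₂ := by
  have hF : ∀ x, StrictMono fun s : ℝ => 4 * a x * Real.exp s / (E x + a x * Real.exp s) :=
    fun x => strictMono_mul_exp_div (hapos x) (hEpos x)
  have hcont : ∀ {w : Pt → ℝ}, ContDiff ℝ 2 w → Continuous fun x =>
      4 * a x * Real.exp (w x) / (E x + a x * Real.exp (w x)) := fun {w} hw => by
    have hwc := hw.continuous
    refine Continuous.div (by fun_prop) (by fun_prop) fun x => ?_
    have := hapos x
    have := hEpos x
    positivity
  have hval := hval₁.trans hval₂.symm
  rcases le_total b₁ b₂ with hb | hb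
  · exact eq_of_le_of_integral_eq hF (hcont hw₁) (hcont hw₂) hint₁ hint₂ hval
      (le_of_lapl_eq_of_tendsto hF hw₁ hw₂ heq₁ heq₂ hlim₁ hlim₂ hb)
  · exact (eq_of_le_of_integral_eq hF (hcont hw₂) (hcont hw₁) hint₂ hint₁ hval.symm
      (le_of_lapl_eq_of_tendsto hF hw₂ hw₁ heq₂ heq₁ hlim₂ hlim₁ hb)).symm
end
end

section
/- Let a, E : ℝ² → ℝ be continuous functions with a(x) > 0 and E(x) > 0 for all x, and let g : ℝ² → ℝ. Suppose w₁, w₂ : ℝ² → ℝ are twice continuously differentiable, w₁(x) → b₁ and w₂(x) → b₂ as |x| → ∞ with b₁, b₂ ∈ ℝ and b₁ ≥ b₂, and for all x ∈ ℝ²: Δw₁(x) ≤ 4a(x)e^{w₁(x)}/(E(x) + a(x)e^{w₁(x)}) − g(x) and Δw₂(x) ≥ 4a(x)e^{w₂(x)}/(E(x) + a(x)e^{w₂(x)}) − g(x). Then w₁(x) ≥ w₂(x) for all x ∈ ℝ². -/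
open Real MeasureTheory Metric Set Filter

noncomputable section

theorem contDiff_fderiv_apply_const {f : Pt → ℝ} (hf : ContDiff ℝ 2 f) (e : Pt) :
    ContDiff ℝ 1 (fun y => fderiv ℝ f y e) :=
  (hf.fderiv_right (m := 1) (by norm_num)).clm_apply contDiff_const

theorem IsLocalMax.deriv_deriv_nonpos {φ : ℝ → ℝ} {t : ℝ} (hφ : ContinuousAt φ t)
    (hmax : IsLocalMax φ t) : deriv (deriv φ) t ≤ 0 := by
  by_contra! hpos
  have hmin := isLocalMin_of_deriv_deriv_pos hpos hmax.deriv_eq_zero hφ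
  have hconst : φ =ᶠ[nhds t] fun _ => φ t := by
    filter_upwards [hmax, hmin] with s hs hs' using le_antisymm hs hs'
  have hzero : deriv (deriv φ) t = 0 := by
    rw [hconst.deriv.deriv_eq]
    simp
  exact hpos.ne' hzero

theorem lapl_nonpos_of_isLocalMax {f : Pt → ℝ} (hf : ContDiff ℝ 2 f) {p : Pt}
    (hmax : IsLocalMax f p) : lapl f p ≤ 0 := by
  refine Finset.sum_nonpos fun i _ => ?_
  set e : Pt := EuclideanSpace.single i 1
  have hline : ∀ t : ℝ, HasDerivAt (fun s : ℝ => p + s • e) e t := fun t => by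
    simpa using ((hasDerivAt_id t).smul_const e).const_add p
  have hzero : p + (0 : ℝ) • e = p := by simp
  have hderiv : deriv (fun s : ℝ => f (p + s • e)) = fun s => fderiv ℝ f (p + s • e) e := by
    funext t
    exact ((hf.differentiable (by norm_num) _).hasFDerivAt.comp_hasDerivAt t (hline t)).deriv
  have hderiv₂ : deriv (fun s : ℝ => fderiv ℝ f (p + s • e) e) 0 =
      fderiv ℝ (fun y => fderiv ℝ f y e) p e := by
    have h := (((contDiff_fderiv_apply_const hf e).differentiable (by norm_num)
      (p + (0 : ℝ) • e)).hasFDerivAt.comp_hasDerivAt 0 (hline 0)).deriv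
    rw [hzero] at h
    exact h
  have hlocal : IsLocalMax (fun s : ℝ => f (p + s • e)) 0 := by
    have ht : Tendsto (fun s : ℝ => p + s • e) (nhds 0) (nhds p) := by
      simpa [hzero] using (hline 0).continuousAt.tendsto
    have h := ht.eventually hmax
    simpa [IsLocalMax, IsMaxFilter] using h
  have hcont : ContinuousAt (fun s : ℝ => f (p + s • e)) 0 :=
    (hf.continuous.comp (by fun_prop)).continuousAt
  rw [← hderiv₂, ← hderiv]
  exact hlocal.deriv_deriv_nonpos hcont

theorem exists_forall_le_of_tendsto_cocompact {f : Pt → ℝ} (hf : Continuous f) {b : ℝ}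
    (hlim : Tendsto f (cocompact Pt) (nhds b)) {x : Pt} (hx : b < f x) :
    ∃ p, ∀ y, f y ≤ f p :=
  hf.exists_forall_ge' x ((hlim.eventually_lt_const hx).mono fun _ h => h.le)

theorem strictMono_exp_div_add_exp {A B : ℝ} (hA : 0 < A) (hB : 0 < B) :
    StrictMono fun t : ℝ => 4 * A * Real.exp t / (B + A * Real.exp t) := by
  intro s t hst
  have hexp := Real.exp_lt_exp.2 hst
  have hs := Real.exp_pos s
  have ht := Real.exp_pos t
  simp only
  rw [div_lt_div_iff₀ (by positivity) (by positivity)]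
  have h := mul_lt_mul_of_pos_left hexp (mul_pos hA hB)
  linarith

/-- comparison principle for super- and subsolutions. -/
theorem statement2 (a E g : Pt → ℝ) (ha : Continuous a) (hE : Continuous E)
    (hapos : ∀ x : Pt, 0 < a x) (hEpos : ∀ x : Pt, 0 < E x)
    (w₁ w₂ : Pt → ℝ) (b₁ b₂ : ℝ)
    (hw₁ : ContDiff ℝ 2 w₁) (hw₂ : ContDiff ℝ 2 w₂)
    (hlim₁ : Tendsto w₁ (cocompact Pt) (nhds b₁))
    (hlim₂ : Tendsto w₂ (cocompact Pt) (nhds b₂))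
    (hb : b₂ ≤ b₁)
    (hsuper : ∀ x : Pt, lapl w₁ x ≤
      4 * a x * Real.exp (w₁ x) / (E x + a x * Real.exp (w₁ x)) - g x)
    (hsub : ∀ x : Pt,
      4 * a x * Real.exp (w₂ x) / (E x + a x * Real.exp (w₂ x)) - g x ≤ lapl w₂ x) :
    ∀ x : Pt, w₂ x ≤ w₁ x := by
  intro x
  by_contra! hx
  have hlim := hlim₂.sub hlim₁
  have hcont : Continuous fun y => w₂ y - w₁ y := hw₂.continuous.sub hw₁.continuous
  obtain ⟨p, hp⟩ := exists_forall_le_of_tendsto_cocompact hcont hlim (x := x) (by linarith)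
  have hlt : w₁ p < w₂ p := by linarith [hp x]
  have hlapl : lapl (fun y => w₂ y - w₁ y) p ≤ 0 :=
    lapl_nonpos_of_isLocalMax (hw₂.sub hw₁) (Eventually.of_forall hp)
  rw [lapl_sub hw₂ hw₁] at hlapl
  have hmono := strictMono_exp_div_add_exp (hapos p) (hEpos p) hlt
  simp only at hmono
  linarith [hsuper p, hsub p]
end
end

section
/- Let B > 2, c₂ > 0 and M₀ > 0. Then there exists c₅ > 0, depending only on B, c₂ and M₀ (in particular independent of β), such that for every β ∈ (2, B], every F ∈ L¹(ℝ²) with ‖F‖_{L¹(ℝ²)} ≤ M₀, ∫_{ℝ²} F dx = 0, and |F(x)| ≤ c₂ |x|^{−β} for almost every x with |x| ≥ e, and every x ∈ ℝ² satisfying e < |x|^{1/(β−1)} < |x|/4, one has |(Γ∗F)(x)| ≤ (c₅/(β−2)²) · |x|^{−(β−2)/(β−1)}. -/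
open Real MeasureTheory Metric Set Filter

noncomputable section

/-- Fundamental solution of −Δ in ℝ². -/
def Gam (x : Pt) : ℝ := -(1 / (2 * Real.pi)) * Real.log ‖x‖

/-- Convolution with the fundamental solution Γ. -/
def conv (F : Pt → ℝ) (x : Pt) : ℝ := ∫ y : Pt, Gam (x - y) * F y

/-- Polar integration of a radial function in the plane. -/
lemma integral_radial_eq (g : ℝ → ℝ) :
    ∫ y : Pt, g ‖y‖ = 2 * (volume.real (ball (0 : Pt) 1) * ∫ s in Ioi (0 : ℝ), s * g s) := by
  have h := integral_fun_norm_addHaar (volume : Measure Pt) g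
  simpa [nsmul_eq_mul, smul_eq_mul] using h

lemma integrable_radial_iff (g : ℝ → ℝ) :
    Integrable (fun y : Pt => g ‖y‖) ↔ IntegrableOn (fun s : ℝ => s * g s) (Ioi 0) := by
  have h := integrable_fun_norm_addHaar (volume : Measure Pt) (f := g)
  simpa [smul_eq_mul] using h

lemma mul_indicator_Ioi_rpow {a R : ℝ} (hR : 0 < R) :
    (fun s : ℝ => s * (Ioi R).indicator (fun t => t ^ (-a)) s)
      = (Ioi R).indicator (fun s => s ^ (1 - a)) := by
  funext s
  by_cases hs : s ∈ Ioi R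
  · have hs0 : 0 < s := hR.trans hs
    rw [indicator_of_mem hs, indicator_of_mem hs, sub_eq_add_neg, rpow_add hs0, rpow_one]
  · simp [indicator_of_notMem hs]

lemma integrable_indicator_Ioi_rpow_norm {a R : ℝ} (ha : 2 < a) (hR : 0 < R) :
    Integrable fun y : Pt => (Ioi R).indicator (fun s => s ^ (-a)) ‖y‖ := by
  rw [integrable_radial_iff, mul_indicator_Ioi_rpow hR]
  exact ((integrable_indicator_iff measurableSet_Ioi).2
    (integrableOn_Ioi_rpow_of_lt (by linarith) hR)).integrableOn

lemma integral_indicator_Ioi_rpow_norm {a R : ℝ} (ha : 2 < a) (hR : 0 < R) :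
    ∫ y : Pt, (Ioi R).indicator (fun s => s ^ (-a)) ‖y‖
      = 2 * (volume.real (ball (0 : Pt) 1) * (R ^ (2 - a) / (a - 2))) := by
  rw [integral_radial_eq, mul_indicator_Ioi_rpow hR, setIntegral_indicator measurableSet_Ioi,
    inter_eq_self_of_subset_right (Ioi_subset_Ioi hR.le),
    integral_Ioi_rpow_of_lt (by linarith) hR, show 1 - a + 1 = 2 - a by ring, neg_div,
    ← div_neg, neg_sub]

lemma eqOn_mul_indicator_Iio_div (r : ℝ) :
    EqOn (fun s : ℝ => s * (Iio r).indicator (fun t => r / t) s)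
      ((Iio r).indicator fun _ => r) (Ioi 0) := by
  intro s hs
  have hs0 : s ≠ 0 := ne_of_gt hs
  by_cases h : s ∈ Iio r
  · simp only [indicator_of_mem h]
    field_simp
  · simp [indicator_of_notMem h]

lemma integrable_indicator_Iio_div_norm (r : ℝ) :
    Integrable fun y : Pt => (Iio r).indicator (fun s => r / s) ‖y‖ := by
  rw [integrable_radial_iff, integrableOn_congr_fun (eqOn_mul_indicator_Iio_div r)
    measurableSet_Ioi, integrableOn_indicator_iff measurableSet_Iio, inter_comm, Ioi_inter_Iio]
  exact integrableOn_const (by simp)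

lemma integral_indicator_Iio_div_norm {r : ℝ} (hr : 0 ≤ r) :
    ∫ y : Pt, (Iio r).indicator (fun s => r / s) ‖y‖
      = 2 * (volume.real (ball (0 : Pt) 1) * (r * r)) := by
  rw [integral_radial_eq, setIntegral_congr_fun measurableSet_Ioi (eqOn_mul_indicator_Iio_div r),
    setIntegral_indicator measurableSet_Iio, Ioi_inter_Iio]
  simp [hr]

lemma abs_log_norm_sub_le_near {x y : Pt} {R : ℝ} (hR : R < ‖x‖ / 4) (hy : ‖y‖ ≤ R) :
    |Real.log ‖x - y‖ - Real.log ‖x‖| ≤ 2 * (R / ‖x‖) := by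
  have hR0 : 0 ≤ R := (norm_nonneg y).trans hy
  have hr : 0 < ‖x‖ := by linarith
  have h₁ : ‖x - y‖ ≤ ‖x‖ + R := (norm_sub_le x y).trans (by linarith)
  have h₂ : ‖x‖ - R ≤ ‖x - y‖ := le_trans (by linarith) (norm_sub_norm_le x y)
  have hu : 0 < ‖x - y‖ := by linarith
  have hq : 0 ≤ R / ‖x‖ := by positivity
  rw [abs_le]
  constructor
  · have h := Real.log_le_sub_one_of_pos (div_pos hr hu)
    rw [Real.log_div hr.ne' hu.ne'] at h
    have : ‖x‖ / ‖x - y‖ - 1 ≤ 2 * (R / ‖x‖) := by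
      rw [div_sub_one hu.ne', ← mul_div_assoc, div_le_div_iff₀ hu hr]
      nlinarith
    linarith
  · have h := Real.log_le_sub_one_of_pos (div_pos hu hr)
    rw [Real.log_div hu.ne' hr.ne'] at h
    have : ‖x - y‖ / ‖x‖ - 1 ≤ R / ‖x‖ := by
      rw [div_sub_one hr.ne']
      gcongr
      linarith
    linarith

lemma log_norm_sub_le_far {x y : Pt} {R ε : ℝ} (hε : 0 < ε) (hR : 0 < R) (hRx : R ≤ ‖x‖)
    (hy : R < ‖y‖) (hxy : x ≠ y) :
    Real.log ‖x - y‖ - Real.log ‖x‖ ≤ (1 + 1 / ε) * (‖y‖ / R) ^ ε := by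
  have hr : 0 < ‖x‖ := hR.trans_le hRx
  have hu : 0 < ‖x - y‖ := norm_pos_iff.2 (sub_ne_zero.2 hxy)
  have hy0 : 0 < ‖y‖ := hR.trans hy
  have hq : 1 ≤ ‖y‖ / R := (one_le_div hR).2 hy.le
  have hquot : ‖x - y‖ / ‖x‖ ≤ 2 * (‖y‖ / R) := by
    rw [div_le_iff₀ hr]
    calc ‖x - y‖ ≤ ‖x‖ + ‖y‖ := norm_sub_le x y
      _ ≤ ‖y‖ / R * ‖x‖ + ‖y‖ / R * ‖x‖ := by
        gcongr
        · nlinarith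
        · rw [div_mul_eq_mul_div, le_div_iff₀ hR]
          gcongr
      _ = _ := by ring
  have hlog := Real.log_le_log (div_pos hu hr) hquot
  rw [Real.log_div hu.ne' hr.ne', Real.log_mul two_ne_zero (by positivity)] at hlog
  have h₁ := Real.log_le_rpow_div (by positivity : 0 ≤ ‖y‖ / R) hε
  have h₂ : 1 ≤ (‖y‖ / R) ^ ε := Real.one_le_rpow hq hε.le
  have h₃ := Real.log_two_lt_d9
  calc _ ≤ Real.log 2 + Real.log (‖y‖ / R) := hlog
    _ ≤ (‖y‖ / R) ^ ε + (‖y‖ / R) ^ ε / ε := by linarith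
    _ = _ := by ring

lemma abs_log_norm_sub_le_far {x y : Pt} {R ε : ℝ} (hε : 0 < ε) (hR : 0 < R) (hRx : R ≤ ‖x‖)
    (hy : R < ‖y‖) (hxy : x ≠ y) (h : ‖x‖ / 2 ≤ ‖x - y‖) :
    |Real.log ‖x - y‖ - Real.log ‖x‖| ≤ (1 + 1 / ε) * (‖y‖ / R) ^ ε := by
  refine abs_le.2 ⟨?_, log_norm_sub_le_far hε hR hRx hy hxy⟩
  have hr : 0 < ‖x‖ := hR.trans_le hRx
  have hlog := Real.log_le_log (by positivity) h
  rw [Real.log_div hr.ne' two_ne_zero] at hlog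
  have h₂ : 1 ≤ (‖y‖ / R) ^ ε := Real.one_le_rpow ((one_le_div hR).2 hy.le) hε.le
  have h₃ := Real.log_two_lt_d9
  have h₄ : 0 < 1 / ε := by positivity
  nlinarith

lemma abs_log_norm_sub_le_of_close {x y : Pt} (hxy : x ≠ y) (h : ‖x - y‖ < ‖x‖) :
    |Real.log ‖x - y‖ - Real.log ‖x‖| ≤ ‖x‖ / ‖x - y‖ := by
  have hu : 0 < ‖x - y‖ := norm_pos_iff.2 (sub_ne_zero.2 hxy)
  have hr : 0 < ‖x‖ := hu.trans h
  have hlog := Real.log_le_log hu h.le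
  rw [abs_of_nonpos (by linarith), neg_sub, ← Real.log_div hr.ne' hu.ne']
  exact Real.log_le_self (by positivity)

/-- Pointwise majorant of the integrand of `Γ∗F` after subtracting `Γ(x)`. -/
lemma abs_log_mul_le {x y : Pt} {β R c f : ℝ} (hβ : 2 < β) (hc : 0 ≤ c) (hR : 0 < R)
    (hRx : R < ‖x‖ / 4) (hxy : x ≠ y) (hf : R < ‖y‖ → |f| ≤ c * ‖y‖ ^ (-β)) :
    |(Real.log ‖x - y‖ - Real.log ‖x‖) * f| ≤
      2 * (R / ‖x‖) * |f|
      + c * (β / (β - 2)) * R ^ (-((β - 2) / 2)) *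
          (Ioi R).indicator (fun s => s ^ (-((β + 2) / 2))) ‖y‖
      + c * (‖x‖ / 2) ^ (-β) * (Iio ‖x‖).indicator (fun s => ‖x‖ / s) ‖x - y‖ := by
  have hr : 0 < ‖x‖ := by linarith
  have hd : 0 < β - 2 := by linarith
  have hi₁ : 0 ≤ (Ioi R).indicator (fun s : ℝ => s ^ (-((β + 2) / 2))) ‖y‖ :=
    indicator_apply_nonneg fun _ => by positivity
  have hi₂ : 0 ≤ (Iio ‖x‖).indicator (fun s : ℝ => ‖x‖ / s) ‖x - y‖ :=
    indicator_apply_nonneg fun _ => by positivity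
  have h₁ : 0 ≤ 2 * (R / ‖x‖) * |f| := by positivity
  have h₂ : 0 ≤ c * (β / (β - 2)) * R ^ (-((β - 2) / 2)) *
      (Ioi R).indicator (fun s : ℝ => s ^ (-((β + 2) / 2))) ‖y‖ := by positivity
  have h₃ : 0 ≤ c * (‖x‖ / 2) ^ (-β) *
      (Iio ‖x‖).indicator (fun s : ℝ => ‖x‖ / s) ‖x - y‖ := by positivity
  rw [abs_mul]
  rcases le_or_gt ‖y‖ R with hy | hy
  · have := mul_le_mul_of_nonneg_right (abs_log_norm_sub_le_near hRx hy) (abs_nonneg f)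
    linarith
  have hy0 : 0 < ‖y‖ := hR.trans hy
  rcases le_or_gt (‖x‖ / 2) ‖x - y‖ with h | h
  · have hlog := abs_log_norm_sub_le_far (half_pos hd) hR (by linarith) hy hxy h
    have key : (1 + 1 / ((β - 2) / 2)) * (‖y‖ / R) ^ ((β - 2) / 2) * (c * ‖y‖ ^ (-β))
        = c * (β / (β - 2)) * R ^ (-((β - 2) / 2)) *
          (Ioi R).indicator (fun s : ℝ => s ^ (-((β + 2) / 2))) ‖y‖ := by
      rw [indicator_of_mem (show ‖y‖ ∈ Ioi R from hy), Real.div_rpow hy0.le hR.le,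
        show -((β + 2) / 2) = (β - 2) / 2 + -β by ring, Real.rpow_add hy0, Real.rpow_neg hR.le]
      field_simp
      ring
    have := mul_le_mul hlog (hf hy) (abs_nonneg f) (by positivity)
    linarith
  · have hlog := abs_log_norm_sub_le_of_close hxy (by linarith)
    have hxy' : ‖x‖ / 2 ≤ ‖y‖ := by
      have := norm_sub_norm_le x y
      linarith
    have hpow : ‖y‖ ^ (-β) ≤ (‖x‖ / 2) ^ (-β) :=
      Real.rpow_le_rpow_of_nonpos (by positivity) hxy' (by linarith)
    have hf' : |f| ≤ c * (‖x‖ / 2) ^ (-β) := (hf hy).trans (by gcongr)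
    have := mul_le_mul hlog hf' (abs_nonneg f) (by positivity)
    rw [indicator_of_mem (show ‖x - y‖ ∈ Iio ‖x‖ by rw [mem_Iio]; linarith)] at h₃ ⊢
    linarith

lemma conv_eq_of_integral_eq_zero {F : Pt → ℝ} {x : Pt} (hF : Integrable F)
    (h₀ : ∫ y : Pt, F y = 0) (hI : Integrable fun y : Pt => Gam (x - y) * F y) :
    conv F x =
      -(1 / (2 * Real.pi)) * ∫ y : Pt, (Real.log ‖x - y‖ - Real.log ‖x‖) * F y := by
  have h : conv F x = ∫ y : Pt, (Gam (x - y) * F y - Gam x * F y) := by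
    rw [integral_sub hI (hF.const_mul _), integral_const_mul, h₀, mul_zero, sub_zero, conv]
  rw [h, ← integral_const_mul]
  congr 1 with y
  simp only [Gam]
  ring

/-- The splitting estimate at an arbitrary radius `R < ‖x‖ / 4`. -/
lemma abs_conv_le {β R c M : ℝ} {F : Pt → ℝ} {x : Pt} (hβ : 2 < β) (hc : 0 ≤ c) (hR : 0 < R)
    (hRx : R < ‖x‖ / 4) (hF : Integrable F) (hM : ∫ y : Pt, |F y| ≤ M)
    (h₀ : ∫ y : Pt, F y = 0) (hdecay : ∀ᵐ y : Pt, R < ‖y‖ → |F y| ≤ c * ‖y‖ ^ (-β)) :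
    |conv F x| ≤ 2 * (R / ‖x‖) * M
      + 4 * c * β * volume.real (ball (0 : Pt) 1) / (β - 2) ^ 2 * R ^ (2 - β)
      + 2 * c * 2 ^ β * volume.real (ball (0 : Pt) 1) * ‖x‖ ^ (2 - β) := by
  have hr : 0 < ‖x‖ := by linarith
  have hd : 0 < β - 2 := by linarith
  have hM0 : 0 ≤ M := (integral_nonneg fun y => abs_nonneg (F y)).trans hM
  by_cases hI : Integrable fun y : Pt => Gam (x - y) * F y
  swap
  · rw [conv, integral_undef hI, abs_zero]
    positivity
  have hi₁ : Integrable fun y : Pt => 2 * (R / ‖x‖) * |F y| := hF.abs.const_mul _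
  have hi₂ : Integrable fun y : Pt => c * (β / (β - 2)) * R ^ (-((β - 2) / 2)) *
      (Ioi R).indicator (fun s => s ^ (-((β + 2) / 2))) ‖y‖ :=
    (integrable_indicator_Ioi_rpow_norm (by linarith) hR).const_mul _
  have hi₃ : Integrable fun y : Pt => c * (‖x‖ / 2) ^ (-β) *
      (Iio ‖x‖).indicator (fun s => ‖x‖ / s) ‖x - y‖ :=
    ((integrable_indicator_Iio_div_norm ‖x‖).comp_sub_left x).const_mul _
  have hne : ∀ᵐ y : Pt, x ≠ y := by
    filter_upwards [compl_mem_ae_iff.2 (measure_singleton (μ := (volume : Measure Pt)) x)]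
      with y hy using fun h => hy h.symm
  have hbound := norm_integral_le_of_norm_le ((hi₁.add hi₂).add hi₃)
    (f := fun y : Pt => (Real.log ‖x - y‖ - Real.log ‖x‖) * F y) (by
      filter_upwards [hdecay, hne] with y hy hxy
      exact abs_log_mul_le hβ hc hR hRx hxy hy)
  rw [integral_add' (hi₁.add hi₂) hi₃, integral_add' hi₁ hi₂, integral_const_mul,
    integral_const_mul, integral_const_mul,
    integral_indicator_Ioi_rpow_norm (by linarith) hR,
    integral_sub_left_eq_self (fun z : Pt => (Iio ‖x‖).indicator (fun s => ‖x‖ / s) ‖z‖),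
    integral_indicator_Iio_div_norm hr.le, Real.norm_eq_abs] at hbound
  have e₁ : R ^ (-((β - 2) / 2)) * R ^ (2 - (β + 2) / 2) = R ^ (2 - β) := by
    rw [← Real.rpow_add hR]
    congr 1
    ring
  have e₂ : (‖x‖ / 2) ^ (-β) * (‖x‖ * ‖x‖) = 2 ^ β * ‖x‖ ^ (2 - β) := by
    rw [Real.div_rpow hr.le zero_le_two, Real.rpow_neg zero_le_two, Real.rpow_sub hr,
      Real.rpow_neg hr.le, Real.rpow_two]
    field_simp
  have e₃ : c * (β / (β - 2)) * R ^ (-((β - 2) / 2)) *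
      (2 * (volume.real (ball (0 : Pt) 1) * (R ^ (2 - (β + 2) / 2) / ((β + 2) / 2 - 2))))
      = 4 * c * β * volume.real (ball (0 : Pt) 1) / (β - 2) ^ 2 * R ^ (2 - β) := by
    rw [← e₁, show (β + 2) / 2 - 2 = (β - 2) / 2 by ring]
    field_simp
    ring
  have e₄ : c * (‖x‖ / 2) ^ (-β) * (2 * (volume.real (ball (0 : Pt) 1) * (‖x‖ * ‖x‖)))
      = 2 * c * 2 ^ β * volume.real (ball (0 : Pt) 1) * ‖x‖ ^ (2 - β) := by
    linear_combination 2 * c * volume.real (ball (0 : Pt) 1) * e₂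
  rw [e₃, e₄] at hbound
  have hpi : 1 / (2 * Real.pi) ≤ 1 := by
    rw [div_le_one (by positivity)]
    linarith [Real.two_le_pi]
  have hmass : 2 * (R / ‖x‖) * ∫ y : Pt, |F y| ≤ 2 * (R / ‖x‖) * M := by gcongr
  rw [conv_eq_of_integral_eq_zero hF h₀ hI, abs_mul, abs_neg,
    abs_of_pos (by positivity : 0 < 1 / (2 * Real.pi))]
  refine (mul_le_of_le_one_left (abs_nonneg _) hpi).trans (hbound.trans ?_)
  linarith

/-- decay of Γ∗F for F with zero mean and decay |F(x)| ≤ c₂|x|^{−β}. -/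
theorem statement9 (B c₂ M₀ : ℝ) (hB : 2 < B) (hc₂ : 0 < c₂) (hM₀ : 0 < M₀) :
    ∃ c₅ : ℝ, 0 < c₅ ∧
      ∀ β : ℝ, 2 < β → β ≤ B →
        ∀ F : Pt → ℝ, Integrable F →
          (∫ y : Pt, |F y|) ≤ M₀ →
          (∫ y : Pt, F y) = 0 →
          (∀ᵐ y : Pt, Real.exp 1 ≤ ‖y‖ → |F y| ≤ c₂ * ‖y‖ ^ (-β)) →
          ∀ x : Pt, Real.exp 1 < ‖x‖ ^ (1 / (β - 1)) → ‖x‖ ^ (1 / (β - 1)) < ‖x‖ / 4 →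
            |conv F x| ≤ c₅ / (β - 2) ^ 2 * ‖x‖ ^ (-((β - 2) / (β - 1))) := by
  set V := volume.real (ball (0 : Pt) 1)
  have hV : 0 ≤ V := measureReal_nonneg
  refine ⟨2 * M₀ * (B - 2) ^ 2 + 4 * c₂ * B * V + 2 * c₂ * 2 ^ B * V * (B - 2) ^ 2, ?_, ?_⟩
  · have : 0 < B - 2 := by linarith
    positivity
  intro β hβ hβB F hF hM h₀ hdecay x hx₁ hx₂
  set R := ‖x‖ ^ (1 / (β - 1))
  have hR : 0 < R := (Real.exp_pos 1).trans hx₁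
  have hr : 0 < ‖x‖ := by linarith
  have hd : 0 < β - 2 := by linarith
  have hβ1 : β - 1 ≠ 0 := by linarith
  have hquot : R / ‖x‖ = ‖x‖ ^ (-((β - 2) / (β - 1))) := by
    rw [← Real.rpow_sub_one hr.ne']
    congr 1
    field_simp
    ring
  have hpow : R ^ (2 - β) = ‖x‖ ^ (-((β - 2) / (β - 1))) := by
    rw [← Real.rpow_mul hr.le]
    congr 1
    field_simp
    ring
  have hpow' : ‖x‖ ^ (2 - β) ≤ ‖x‖ ^ (-((β - 2) / (β - 1))) := by
    rw [← hpow]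
    exact Real.rpow_le_rpow_of_nonpos hR (by linarith) (by linarith)
  have hmain := abs_conv_le hβ hc₂.le hR hx₂ hF hM h₀
    (hdecay.mono fun y hy h => hy (hx₁.trans h).le)
  rw [hquot, hpow] at hmain
  set Q := ‖x‖ ^ (-((β - 2) / (β - 1)))
  have hQ : 0 ≤ Q := by positivity
  have hone : 1 ≤ (B - 2) ^ 2 / (β - 2) ^ 2 := by
    rw [one_le_div (by positivity)]
    gcongr
  have h2 : (2 : ℝ) ^ β ≤ 2 ^ B := Real.rpow_le_rpow_of_exponent_le one_le_two hβB
  calc |conv F x| ≤ 2 * Q * M₀ + 4 * c₂ * β * V / (β - 2) ^ 2 * Q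
        + 2 * c₂ * 2 ^ β * V * ‖x‖ ^ (2 - β) := hmain
    _ ≤ 2 * Q * M₀ * 1 + 4 * c₂ * B * V / (β - 2) ^ 2 * Q
        + 2 * c₂ * 2 ^ B * V * Q * 1 := by
      rw [mul_one, mul_one]
      gcongr
    _ ≤ 2 * Q * M₀ * ((B - 2) ^ 2 / (β - 2) ^ 2) + 4 * c₂ * B * V / (β - 2) ^ 2 * Q
        + 2 * c₂ * 2 ^ B * V * Q * ((B - 2) ^ 2 / (β - 2) ^ 2) := by gcongr
    _ = _ := by ring
end
end

section
/- Let β > 2, C > 0, b ∈ ℝ, and let F : ℝ² → ℝ be continuous with ∫_{ℝ²} F dx = 0 and |F(x)| ≤ C(1+|x|)^{−β} for all x ∈ ℝ². If v : ℝ² → ℝ is twice continuously differentiable, satisfies Δv(x) = F(x) for all x ∈ ℝ², and v(x) → b as |x| → ∞, then v(x) = b − (Γ∗F)(x) for all x ∈ ℝ². -/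
open Real MeasureTheory Metric Set Filter

noncomputable section

/-- The unit vector at angle `θ`. -/
def unitDir (θ : ℝ) : Pt :=
  cos θ • EuclideanSpace.single 0 1 + sin θ • EuclideanSpace.single 1 1

/-- The unit tangent vector at angle `θ`. -/
def unitTan (θ : ℝ) : Pt :=
  (-sin θ) • EuclideanSpace.single 0 1 + cos θ • EuclideanSpace.single 1 1

lemma hasDerivAt_unitDir (θ : ℝ) : HasDerivAt unitDir (unitTan θ) θ :=
  ((hasDerivAt_cos θ).smul_const _).add ((hasDerivAt_sin θ).smul_const _)

lemma hasDerivAt_unitTan (θ : ℝ) : HasDerivAt unitTan (-unitDir θ) θ := by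
  refine (((hasDerivAt_sin θ).neg.smul_const (EuclideanSpace.single 0 1 : Pt)).add
    ((hasDerivAt_cos θ).smul_const (EuclideanSpace.single 1 1 : Pt))).congr_deriv ?_
  simp only [unitDir]
  module

@[fun_prop]
lemma continuous_unitDir : Continuous unitDir := by unfold unitDir; fun_prop

@[fun_prop]
lemma continuous_unitTan : Continuous unitTan := by unfold unitTan; fun_prop

lemma norm_unitDir (θ : ℝ) : ‖unitDir θ‖ = 1 := by
  rw [EuclideanSpace.norm_eq]
  simp [unitDir, Fin.sum_univ_two]

lemma norm_smul_unitDir {r : ℝ} (hr : 0 ≤ r) (θ : ℝ) : ‖r • unitDir θ‖ = r := by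
  rw [norm_smul, norm_unitDir, mul_one, Real.norm_of_nonneg hr]

lemma integral_eq_setIntegral_polar (g : Pt → ℝ) :
    ∫ y, g y = ∫ p in Ioi (0 : ℝ) ×ˢ Ioo (-π) π, p.1 * g (p.1 • unitDir p.2) := by
  let e : Pt ≃ᵐ ℝ × ℝ :=
    (MeasurableEquiv.toLp 2 (Fin 2 → ℝ)).symm.trans MeasurableEquiv.finTwoArrow
  have he : MeasurePreserving e volume volume :=
    (volume_preserving_finTwoArrow ℝ).comp
      (EuclideanSpace.volume_preserving_symm_measurableEquiv_toLp (Fin 2))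
  rw [← he.symm.integral_comp e.symm.measurableEmbedding, ← integral_comp_polarCoord_symm]
  refine setIntegral_congr_fun polarCoord.open_target.measurableSet fun p _ => ?_
  have : e.symm (polarCoord.symm p) = p.1 • unitDir p.2 := by
    ext i
    fin_cases i <;> simp [e, unitDir, polarCoord]
  simp only [this, smul_eq_mul]

/-- Integration in polar coordinates, for a function with an integrable radial majorant. -/
lemma integral_eq_integral_radial {g : Pt → ℝ} (hg : Measurable g) {h : ℝ → ℝ}
    (hh : IntegrableOn h (Ioi 0)) (hgh : ∀ r > 0, ∀ θ, |r * g (r • unitDir θ)| ≤ h r) :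
    IntegrableOn (fun r => r * ∫ θ in -π..π, g (r • unitDir θ)) (Ioi 0) ∧
      ∫ y, g y = ∫ r in Ioi (0 : ℝ), r * ∫ θ in -π..π, g (r • unitDir θ) := by
  have hint : IntegrableOn (fun p : ℝ × ℝ => p.1 * g (p.1 • unitDir p.2))
      (Ioi (0 : ℝ) ×ˢ Ioo (-π) π) (volume.prod volume) := by
    have hmaj : IntegrableOn (fun p : ℝ × ℝ => h p.1) (Ioi (0 : ℝ) ×ˢ Ioo (-π) π)
        (volume.prod volume) := by
      rw [IntegrableOn, ← Measure.prod_restrict]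
      exact hh.comp_fst _
    refine hmaj.mono' (Measurable.aestronglyMeasurable ?_) ?_
    · exact measurable_fst.mul (hg.comp (by fun_prop))
    filter_upwards [ae_restrict_mem (measurableSet_Ioi.prod measurableSet_Ioo)] with p hp
    exact hgh _ hp.1 _
  have hinner : ∀ r, ∫ θ in Ioo (-π) π, r * g (r • unitDir θ)
      = r * ∫ θ in -π..π, g (r • unitDir θ) := fun r => by
    rw [intervalIntegral.integral_of_le (by linarith [pi_pos]), integral_Ioc_eq_integral_Ioo,
      integral_const_mul]
  constructor
  · have := hint
    rw [IntegrableOn, ← Measure.prod_restrict] at this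
    have hl := this.integral_prod_left
    simp only [hinner] at hl
    exact hl
  · rw [integral_eq_setIntegral_polar, Measure.volume_eq_prod, setIntegral_prod _ hint]
    simp only [hinner]

lemma hasDerivAt_intervalIntegral_of_continuous {f f' : ℝ → ℝ → ℝ}
    (hf : Continuous f.uncurry) (hf' : Continuous f'.uncurry)
    (h : ∀ r θ, HasDerivAt (fun s => f s θ) (f' r θ) r) (a b r : ℝ) :
    HasDerivAt (fun s => ∫ θ in a..b, f s θ) (∫ θ in a..b, f' r θ) r := by
  obtain ⟨M, hM⟩ := ((isCompact_closedBall r 1).prod (isCompact_uIcc (a := a) (b := b))).bddAbove_image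
    hf'.norm.continuousOn
  refine (intervalIntegral.hasDerivAt_integral_of_dominated_loc_of_deriv_le (bound := fun _ => M)
    (Metric.closedBall_mem_nhds r one_pos) (.of_forall fun s => ?_) ?_ ?_
    (.of_forall fun θ hθ s hs => ?_) intervalIntegrable_const
    (.of_forall fun θ _ s _ => h s θ)).2
  · exact (hf.comp (Continuous.prodMk_right s)).aestronglyMeasurable
  · exact (hf.comp (Continuous.prodMk_right r)).intervalIntegrable _ _
  · exact (hf'.comp (Continuous.prodMk_right r)).aestronglyMeasurable
  · exact hM ⟨(s, θ), ⟨hs, uIoc_subset_uIcc hθ⟩, rfl⟩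

lemma hasDerivAt_clm_comp_apply {G : Pt → Pt →L[ℝ] ℝ} {γ w : ℝ → Pt} {γ' w' : Pt} {t : ℝ}
    (hG : Differentiable ℝ G) (hγ : HasDerivAt γ γ' t) (hw : HasDerivAt w w' t) :
    HasDerivAt (fun s => G (γ s) (w s)) (fderiv ℝ G (γ t) γ' (w t) + G (γ t) w') t := by
  have hc : HasDerivAt (fun s => G (γ s)) (fderiv ℝ G (γ t) γ') t :=
    (hG (γ t)).hasFDerivAt.comp_hasDerivAt t hγ
  exact hc.clm_apply hw

section SphericalMeans

variable {v : Pt → ℝ}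

lemma hasDerivAt_integral_circle (hv : ContDiff ℝ 2 v) (x : Pt) (r : ℝ) :
    HasDerivAt (fun s => ∫ θ in -π..π, v (x + s • unitDir θ))
      (∫ θ in -π..π, fderiv ℝ v (x + r • unitDir θ) (unitDir θ)) r := by
  have hL : Continuous (fderiv ℝ v) := hv.continuous_fderiv (by norm_num)
  have hvc := hv.continuous
  refine hasDerivAt_intervalIntegral_of_continuous
    (f := fun s θ => v (x + s • unitDir θ))
    (f' := fun s θ => fderiv ℝ v (x + s • unitDir θ) (unitDir θ)) ?_ ?_ (fun s θ => ?_) _ _ _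
  · simp only [Function.uncurry_def]; fun_prop
  · simp only [Function.uncurry_def]; fun_prop
  · have hd := (((hasDerivAt_id s).smul_const (unitDir θ)).const_add x)
    rw [one_smul] at hd
    exact ((hv.differentiable (by norm_num)) _).hasFDerivAt.comp_hasDerivAt s hd

lemma lapl_eq_frame (hv : ContDiff ℝ 2 v) (y : Pt) (θ : ℝ) :
    lapl v y = fderiv ℝ (fderiv ℝ v) y (unitDir θ) (unitDir θ)
      + fderiv ℝ (fderiv ℝ v) y (unitTan θ) (unitTan θ) := by
  have hL : Differentiable ℝ (fderiv ℝ v) :=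
    (hv.fderiv_right (m := 1) (by norm_num)).differentiable (by norm_num)
  have key : ∀ a : Pt, fderiv ℝ (fun z => fderiv ℝ v z a) y a = fderiv ℝ (fderiv ℝ v) y a a := by
    intro a
    rw [fderiv_clm_apply (hL y) (differentiableAt_const a)]
    simp
  simp only [lapl, Fin.sum_univ_two, key, unitDir, unitTan, map_add, map_smul,
    add_apply, smul_apply, smul_eq_mul]
  linear_combination (-(fderiv ℝ (fderiv ℝ v) y (EuclideanSpace.single 0 1)
      (EuclideanSpace.single 0 1) + fderiv ℝ (fderiv ℝ v) y (EuclideanSpace.single 1 1)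
      (EuclideanSpace.single 1 1))) * sin_sq_add_cos_sq θ

/-- The radial flux `r ∂ᵣ` of the circular mean has derivative `r` times the circular mean of the
Laplacian. -/
lemma hasDerivAt_flux (hv : ContDiff ℝ 2 v) (x : Pt) (r : ℝ) :
    HasDerivAt (fun s => s * ∫ θ in -π..π, fderiv ℝ v (x + s • unitDir θ) (unitDir θ))
      (r * ∫ θ in -π..π, lapl v (x + r • unitDir θ)) r := by
  have hL1 : ContDiff ℝ 1 (fderiv ℝ v) := hv.fderiv_right (by norm_num)
  have hLd : Differentiable ℝ (fderiv ℝ v) := hL1.differentiable (by norm_num)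
  have hL : Continuous (fderiv ℝ v) := hL1.continuous
  have hH : Continuous (fderiv ℝ (fderiv ℝ v)) := hL1.continuous_fderiv (by norm_num)
  have hderiv : ∀ s θ : ℝ, HasDerivAt (fun s => fderiv ℝ v (x + s • unitDir θ) (unitDir θ))
      (fderiv ℝ (fderiv ℝ v) (x + s • unitDir θ) (unitDir θ) (unitDir θ)) s := by
    intro s θ
    have hd := (((hasDerivAt_id s).smul_const (unitDir θ)).const_add x)
    rw [one_smul] at hd
    simpa only [map_zero, add_zero, id] using
      hasDerivAt_clm_comp_apply hLd hd (hasDerivAt_const s (unitDir θ))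
  have hint := hasDerivAt_intervalIntegral_of_continuous
    (f := fun s θ => fderiv ℝ v (x + s • unitDir θ) (unitDir θ))
    (f' := fun s θ => fderiv ℝ (fderiv ℝ v) (x + s • unitDir θ) (unitDir θ) (unitDir θ))
    (by simp only [Function.uncurry_def]; fun_prop) (by simp only [Function.uncurry_def]; fun_prop)
    hderiv (-π) π r
  have htan : ∀ θ, HasDerivAt (fun θ => fderiv ℝ v (x + r • unitDir θ) (unitTan θ))
      (r * fderiv ℝ (fderiv ℝ v) (x + r • unitDir θ) (unitTan θ) (unitTan θ)
        - fderiv ℝ v (x + r • unitDir θ) (unitDir θ)) θ := by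
    intro θ
    have hd := ((hasDerivAt_unitDir θ).fun_const_smul r).const_add x
    refine (hasDerivAt_clm_comp_apply hLd hd (hasDerivAt_unitTan θ)).congr_deriv ?_
    rw [map_smul, map_neg, smul_apply, smul_eq_mul, sub_eq_add_neg]
  have hzero : ∫ θ in -π..π, (r * fderiv ℝ (fderiv ℝ v) (x + r • unitDir θ) (unitTan θ) (unitTan θ)
        - fderiv ℝ v (x + r • unitDir θ) (unitDir θ)) = 0 := by
    rw [intervalIntegral.integral_eq_sub_of_hasDerivAt (fun θ _ => htan θ)
      (Continuous.intervalIntegrable (by fun_prop) _ _)]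
    simp [unitDir, unitTan]
  refine ((hasDerivAt_id r).mul hint).congr_deriv ?_
  simp only [id, one_mul]
  rw [intervalIntegral.integral_congr fun θ _ => lapl_eq_frame hv (x + r • unitDir θ) θ,
    ← add_zero (_ + _), ← hzero]
  simp only [← intervalIntegral.integral_const_mul]
  rw [← intervalIntegral.integral_add, ← intervalIntegral.integral_add]
  · refine intervalIntegral.integral_congr fun θ _ => ?_
    ring
  all_goals exact Continuous.intervalIntegrable (by fun_prop) _ _

lemma tendsto_integral_circle {b : ℝ} (hv : Continuous v)
    (hlim : Tendsto v (cocompact Pt) (nhds b)) (x : Pt) :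
    Tendsto (fun r : ℝ => ∫ θ in -π..π, v (x + r • unitDir θ)) atTop (nhds (2 * π * b)) := by
  rw [Metric.tendsto_nhds]
  intro ε hε
  have hπ := pi_pos
  have hev := hlim.eventually (Metric.ball_mem_nhds b (show 0 < ε / (4 * π) by positivity))
  rw [← Metric.cobounded_eq_cocompact,
    (Metric.hasBasis_cobounded_compl_closedBall (0 : Pt)).eventually_iff] at hev
  obtain ⟨R, -, hR⟩ := hev
  filter_upwards [eventually_gt_atTop (R + ‖x‖), eventually_ge_atTop 0] with r hr hr0
  have hbd : ∀ θ ∈ Set.uIoc (-π) π, ‖v (x + r • unitDir θ) - b‖ ≤ ε / (4 * π) := by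
    intro θ _
    have hmem : x + r • unitDir θ ∈ (Metric.closedBall (0 : Pt) R)ᶜ := by
      have h := norm_sub_norm_le (r • unitDir θ) (-x)
      rw [norm_smul_unitDir hr0, norm_neg, sub_neg_eq_add, add_comm _ x] at h
      simp only [mem_compl_iff, mem_closedBall_zero_iff, not_le]
      linarith
    exact (mem_ball_iff_norm.1 (hR hmem)).le
  have hle := intervalIntegral.norm_integral_le_of_norm_le_const hbd
  rw [intervalIntegral.integral_sub (Continuous.intervalIntegrable (by fun_prop) _ _)
    intervalIntegrable_const, intervalIntegral.integral_const, smul_eq_mul,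
    abs_of_pos (by linarith)] at hle
  rw [dist_eq_norm]
  calc _ = ‖(∫ θ in -π..π, v (x + r • unitDir θ)) - (π - -π) * b‖ := by ring_nf
    _ ≤ ε / (4 * π) * (π - -π) := hle
    _ = ε / 2 := by field_simp; ring
    _ < ε := by linarith

end SphericalMeans

lemma mul_abs_log_le {a r : ℝ} (ha : 0 < a) (hr : 0 < r) :
    r * |log r| ≤ (1 + 1 / a) * (1 + r) ^ (1 + a) := by
  have h1 : 1 ≤ (1 + r) ^ (1 + a) := one_le_rpow (by linarith) (by linarith)
  rcases le_total r 1 with h | h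
  · have := abs_log_mul_self_lt r hr h
    rw [abs_mul, abs_of_pos hr, mul_comm] at this
    have : 0 ≤ 1 / a * (1 + r) ^ (1 + a) := by positivity
    linarith
  · rw [abs_of_nonneg (log_nonneg h)]
    have h2 : r ^ a ≤ (1 + r) ^ a := rpow_le_rpow hr.le (by linarith) ha.le
    calc r * log r ≤ (1 + r) * ((1 + r) ^ a / a) := by
          gcongr
          · exact log_nonneg h
          · linarith
          · exact (log_le_rpow_div hr.le ha).trans (by gcongr)
      _ = 1 / a * (1 + r) ^ (1 + a) := by
          rw [rpow_add (by linarith), rpow_one]; ring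
      _ ≤ _ := by linarith

lemma one_add_norm_add_rpow_neg_le {β : ℝ} (hβ : 0 ≤ β) (x y : Pt) :
    (1 + ‖x + y‖) ^ (-β) ≤ (1 + ‖x‖) ^ β * (1 + ‖y‖) ^ (-β) := by
  have h : 1 + ‖y‖ ≤ (1 + ‖x‖) * (1 + ‖x + y‖) := by
    have := norm_sub_norm_le y (-x)
    rw [norm_neg, sub_neg_eq_add, add_comm y x] at this
    nlinarith [norm_nonneg x, norm_nonneg (x + y), mul_nonneg (norm_nonneg x) (norm_nonneg (x + y))]
  have h2 := rpow_le_rpow (by positivity) h hβ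
  rw [mul_rpow (by positivity) (by positivity)] at h2
  rw [rpow_neg (by positivity), rpow_neg (by positivity), ← div_eq_mul_inv,
    inv_le_comm₀ (by positivity) (by positivity), inv_div, div_le_iff₀ (by positivity)]
  linarith

/-- representation v = b − Γ∗F for bounded solutions of Δv = F. -/
theorem statement17 (β C b : ℝ) (hβ : 2 < β) (hC : 0 < C)
    (F : Pt → ℝ) (hFcont : Continuous F) (hFint : Integrable F)
    (hFzero : (∫ x : Pt, F x) = 0)
    (hFbd : ∀ x : Pt, |F x| ≤ C * (1 + ‖x‖) ^ (-β))
    (v : Pt → ℝ) (hv : ContDiff ℝ 2 v)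
    (hΔ : ∀ x : Pt, lapl v x = F x)
    (hlim : Tendsto v (cocompact Pt) (nhds b)) :
    ∀ x : Pt, v x = b - conv F x := by
  intro x
  set a : ℝ := β / 2 - 1 with ha_def
  have ha : 0 < a := by linarith
  set K : ℝ := (1 + 1 / a) * (C * (1 + ‖x‖) ^ β) with hK_def
  have hmaj : IntegrableOn (fun r : ℝ => K * (1 + ‖r‖) ^ (-(β / 2))) (Ioi 0) :=
    ((integrable_one_add_norm (by simp; linarith)).const_mul K).integrableOn
  have hdecay : ∀ r > 0, ∀ θ c, c ≤ (1 + 1 / a) * (1 + r) ^ (1 + a) →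
      c * |F (x + r • unitDir θ)| ≤ K * (1 + ‖r‖) ^ (-(β / 2)) := by
    intro r hr θ c hc
    have h1 := (hFbd (x + r • unitDir θ)).trans (mul_le_mul_of_nonneg_left
      (one_add_norm_add_rpow_neg_le (by linarith : 0 ≤ β) x (r • unitDir θ)) hC.le)
    rw [norm_smul_unitDir hr.le] at h1
    calc c * |F (x + r • unitDir θ)|
        ≤ ((1 + 1 / a) * (1 + r) ^ (1 + a)) * (C * ((1 + ‖x‖) ^ β * (1 + r) ^ (-β))) := by
          gcongr
      _ = K * ((1 + r) ^ (1 + a) * (1 + r) ^ (-β)) := by rw [hK_def]; ring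
      _ = K * (1 + ‖r‖) ^ (-(β / 2)) := by
          rw [← rpow_add (by linarith), Real.norm_of_nonneg hr.le]
          congr 2
          rw [ha_def]; ring
  obtain ⟨hint, heq⟩ := integral_eq_integral_radial (g := fun y => F (x + y)) (by fun_prop) hmaj
    (fun r hr θ => by
      rw [abs_mul, abs_of_pos hr]
      refine hdecay r hr θ r ?_
      have h1 : (1 + r) ^ (1 : ℝ) ≤ (1 + r) ^ (1 + a) :=
        rpow_le_rpow_of_exponent_le (by linarith) (by linarith)
      rw [rpow_one] at h1
      have : 0 ≤ 1 / a * (1 + r) ^ (1 + a) := by positivity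
      linarith)
  obtain ⟨hlint, hleq⟩ := integral_eq_integral_radial (g := fun y => log ‖y‖ * F (x + y))
    (by fun_prop) hmaj
    (fun r hr θ => by
      rw [norm_smul_unitDir hr.le, ← mul_assoc, abs_mul, abs_mul, abs_of_pos hr]
      exact hdecay r hr θ _ (mul_abs_log_le ha hr))
  set φ : ℝ → ℝ := fun r => ∫ θ in -π..π, F (x + r • unitDir θ) with hφ
  have hlog : ∀ r ∈ Ioi (0 : ℝ), r * ∫ θ in -π..π, log ‖r • unitDir θ‖ * F (x + r • unitDir θ)
      = r * φ r * log r := by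
    intro r hr
    simp only [norm_smul_unitDir (le_of_lt hr), intervalIntegral.integral_const_mul, hφ]
    ring
  rw [integrableOn_congr_fun hlog measurableSet_Ioi] at hlint
  rw [setIntegral_congr_fun measurableSet_Ioi hlog] at hleq
  rw [integral_add_left_eq_self, hFzero] at heq
  set m : ℝ → ℝ := fun r => ∫ θ in -π..π, v (x + r • unitDir θ) with hm
  set m' : ℝ → ℝ := fun r => ∫ θ in -π..π, fderiv ℝ v (x + r • unitDir θ) (unitDir θ) with hm'
  have hmderiv : ∀ r, HasDerivAt m (m' r) r := hasDerivAt_integral_circle hv x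
  have hpderiv : ∀ r, HasDerivAt (fun s => s * m' s) (r * φ r) r := fun r => by
    have := hasDerivAt_flux hv x r
    simpa only [hΔ] using this
  have hφcont : Continuous φ :=
    intervalIntegral.continuous_parametric_intervalIntegral_of_continuous'
      (f := fun r θ => F (x + r • unitDir θ))
      (by simp only [Function.uncurry_def]; fun_prop) _ _
  have hm'cont : Continuous m' := by
    have hL : Continuous (fderiv ℝ v) := hv.continuous_fderiv (by norm_num)
    exact intervalIntegral.continuous_parametric_intervalIntegral_of_continuous'
      (f := fun r θ => fderiv ℝ v (x + r • unitDir θ) (unitDir θ))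
      (by simp only [Function.uncurry_def]; fun_prop) _ _
  have htail : ∀ R > 0, R * m' R = -∫ r in Ioi R, r * φ r := by
    intro R hR
    have h1 := intervalIntegral.integral_eq_sub_of_hasDerivAt (a := 0) (b := R)
      (fun r _ => hpderiv r) (Continuous.intervalIntegrable (by fun_prop) _ _)
    have h2 := intervalIntegral.integral_interval_add_Ioi hint (hint.mono_set (Ioi_subset_Ioi hR.le))
    linarith
  have hflux : Tendsto (fun R => R * m' R * log R) atTop (nhds 0) := by
    refine squeeze_zero_norm' ?_
      (tendsto_integral_Ioi_zero (μ := volume) (f := fun r => ‖r * φ r * log r‖) tendsto_id)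
    filter_upwards [eventually_ge_atTop 1] with R hR
    have hR0 : 0 < R := by linarith
    rw [htail R hR0, norm_mul, norm_neg, Real.norm_of_nonneg (log_nonneg hR)]
    calc _ ≤ (∫ r in Ioi R, ‖r * φ r‖) * log R := by
          gcongr
          · exact log_nonneg hR
          · exact norm_integral_le_integral_norm _
      _ = ∫ r in Ioi R, ‖r * φ r‖ * log R := (integral_mul_const _ _).symm
      _ ≤ ∫ r in Ioi R, ‖r * φ r * log r‖ := by
          refine setIntegral_mono_on
            ((hint.mono_set (Ioi_subset_Ioi hR0.le)).norm.mul_const _)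
            (hlint.mono_set (Ioi_subset_Ioi hR0.le)).norm measurableSet_Ioi fun r hr => ?_
          rw [norm_mul (r * φ r) (log r)]
          gcongr
          exact (log_le_log hR0 (le_of_lt hr)).trans (le_abs_self _)
  have hmain := integral_Ioi_of_hasDerivAt_of_tendsto (a := 0) (m := 2 * π * b)
    (f := fun r => m r - m' r * (r * log r)) (f' := fun r => -(r * φ r * log r)) ?_ ?_ hlint.neg ?_
  · have hm0 : m 0 = 2 * π * v x := by
      simp only [hm, zero_smul, add_zero, intervalIntegral.integral_const, smul_eq_mul]
      ring
    have hconv : conv F x = -(1 / (2 * π)) * ∫ r in Ioi (0 : ℝ), r * φ r * log r := by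
      rw [← hleq, conv, ← integral_add_left_eq_self _ x, ← integral_const_mul]
      refine integral_congr_ae (.of_forall fun y => ?_)
      simp only [Gam, sub_add_cancel_left, norm_neg]
      ring
    rw [integral_neg] at hmain
    simp only [zero_mul, mul_zero, sub_zero, hm0] at hmain
    rw [hconv, ← neg_neg (∫ r in Ioi (0 : ℝ), r * φ r * log r), hmain]
    field_simp
    ring
  · have hmcont : Continuous m := continuous_iff_continuousAt.2 fun r => (hmderiv r).continuousAt
    exact (hmcont.sub (hm'cont.mul continuous_mul_log)).continuousWithinAt
  · intro r hr
    have hr0 : r ≠ 0 := ne_of_gt hr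
    have h := (hmderiv r).sub ((hpderiv r).mul (hasDerivAt_log hr0))
    refine (h.congr_deriv ?_).congr_of_eventuallyEq (.of_forall fun s => ?_)
    · field_simp
      ring
    · simp only [Pi.sub_apply, Pi.mul_apply]
      ring
  · have h := (tendsto_integral_circle hv.continuous hlim x).sub hflux
    rw [sub_zero] at h
    refine h.congr fun r => ?_
    simp only [hm]
    ring
end
end
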